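/- There exist constants c, C > 0 such that for every ℓ with 0 < ℓ < 1/2, the second-order structure function of Riemann's non-differentiable function satisfies c · ℓ^{3/2} ≤ S₂(ℓ) ≤ C · ℓ^{3/2}. -/

import Mathlib

open Real MeasureTheory

/-- `σ k = 1` if `k` is a perfect square, `0` otherwise. -/
noncomputable def sqIndicator (k : ℕ) : ℝ := if IsSquare k then 1 else 0

/-- The character `e_k(x) = e^{2πikx}`. -/
noncomputable def eChar (k : ℕ) (x : ℝ) : ℂ :=
  Complex.exp (2 * Real.pi * Complex.I * (k : ℂ) * (x : ℂ))

/-- Riemann's non-differentiable function `R(x) = ∑_{k≥1} (σ_k/k) e^{2πikx}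
    = ∑_{n≥1} e^{2πin²x}/n²`. -/
noncomputable def RiemannF (x : ℝ) : ℂ :=
  ∑' k : ℕ, ((sqIndicator k / k : ℝ) : ℂ) * eChar k x

/-- High-pass filter `R_{≥N}(x) = ∑_{k ≥ N} (σ_k/k) e^{2πikx}`. -/
noncomputable def RiemannHigh (N : ℕ) (x : ℝ) : ℂ :=
  ∑' k : ℕ, if N ≤ k then ((sqIndicator k / k : ℝ) : ℂ) * eChar k x else 0

/-- The structure function `S_p(ℓ) = ∫₀¹ |R(x+ℓ) − R(x)|^p dx` (for natural `p`). -/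
noncomputable def structureFn (p : ℕ) (ℓ : ℝ) : ℝ :=
  ∫ x in (0:ℝ)..1, ‖RiemannF (x + ℓ) - RiemannF x‖ ^ p

/-- Parseval's identity for a convergent expansion along an orthonormal family. -/
theorem Orthonormal.hasSum_norm_sq_of_hasSum {𝕜 E ι : Type*} [RCLike 𝕜] [NormedAddCommGroup E]
    [InnerProductSpace 𝕜 E] {v : ι → E} (hv : Orthonormal 𝕜 v) {a : ι → 𝕜} {x : E}
    (h : HasSum (fun i => a i • v i) x) : HasSum (fun i => ‖a i‖ ^ 2) (‖x‖ ^ 2) := by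
  have h' := (Filter.Tendsto.norm (show Filter.Tendsto _ _ _ from h)).pow 2
  refine Filter.Tendsto.congr (fun s => ?_) h'
  have key : ((‖∑ i ∈ s, a i • v i‖ ^ 2 : ℝ) : 𝕜) = ((∑ i ∈ s, ‖a i‖ ^ 2 : ℝ) : 𝕜) := by
    push_cast
    rw [← inner_self_eq_norm_sq_to_K (𝕜 := 𝕜), hv.inner_sum]
    exact Finset.sum_congr rfl fun i _ => RCLike.conj_mul (a i)
  exact_mod_cast key

/-- Parseval's identity for an absolutely convergent trigonometric series of period one. -/
theorem hasSum_norm_sq_of_summable_fourier {ι : Type*} {m : ι → ℤ} (hm : Function.Injective m)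
    {a : ι → ℂ} (ha : Summable fun i => ‖a i‖) :
    HasSum (fun i => ‖a i‖ ^ 2)
      (∫ x in (0:ℝ)..1, ‖∑' i, a i * fourier (m i) (x : UnitAddCircle)‖ ^ 2) := by
  have hs : Summable fun i => a i • (fourier (m i) : C(UnitAddCircle, ℂ)) :=
    Summable.of_norm (by simpa [norm_smul, fourier_norm] using ha)
  obtain ⟨F, hF⟩ := hs
  have hL := (ContinuousMap.toLp (E := ℂ) 2 (AddCircle.haarAddCircle (T := 1)) ℂ).hasSum hF
  have hP := ((orthonormal_fourier (T := 1)).comp m hm).hasSum_norm_sq_of_hasSum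
    (a := a) (by simpa [Function.comp_def] using hL)
  have hpt (x : ℝ) : ∑' i, a i * fourier (m i) (x : UnitAddCircle) = F (x : UnitAddCircle) := by
    have := (ContinuousMap.hasSum_apply hF (x : UnitAddCircle)).tsum_eq
    simpa only [ContinuousMap.coe_smul, Pi.smul_apply, smul_eq_mul] using this
  convert hP using 1
  have h1 : (((‖ContinuousMap.toLp (E := ℂ) 2 (AddCircle.haarAddCircle (T := 1)) ℂ F‖ ^ 2 : ℝ)) : ℂ)
      = ((∫ t, ‖F t‖ ^ 2 ∂(AddCircle.haarAddCircle (T := 1)) : ℝ) : ℂ) := by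
    push_cast
    rw [← integral_complex_ofReal]
    have := inner_self_eq_norm_sq_to_K (𝕜 := ℂ)
      (ContinuousMap.toLp (E := ℂ) 2 (AddCircle.haarAddCircle (T := 1)) ℂ F)
    rw [ContinuousMap.inner_toLp] at this
    rw [← Complex.coe_algebraMap, ← this]
    refine integral_congr_ae (.of_forall fun t => ?_)
    simp [Complex.mul_conj']
  rw [Complex.ofReal_inj.mp h1, AddCircle.integral_haarAddCircle]
  simp_rw [hpt]
  have := AddCircle.intervalIntegral_preimage (1:ℝ) 0 (fun t => ‖F t‖ ^ 2)
  simpa using this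

theorem RiemannF_eq_tsum_sq (x : ℝ) :
    RiemannF x = ∑' n : ℕ, ((((n : ℝ) ^ 2)⁻¹ : ℝ) : ℂ) * eChar (n ^ 2) x := by
  have hinj : Function.Injective fun n : ℕ => n ^ 2 := fun a b h =>
    Nat.pow_left_injective two_ne_zero h
  rw [RiemannF, ← hinj.tsum_eq]
  · refine tsum_congr fun n => ?_
    simp [sqIndicator, IsSquare.sq]
  · intro k hk
    by_contra hk'
    refine hk ?_
    have : ¬ IsSquare k := fun ⟨r, hr⟩ => hk' ⟨r, by simp [hr, sq]⟩
    simp [sqIndicator, this]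

theorem eChar_eq_fourier (k : ℕ) (x : ℝ) : eChar k x = fourier (k : ℤ) (x : UnitAddCircle) := by
  rw [fourier_coe_apply]
  simp [eChar]

theorem norm_eChar (k : ℕ) (x : ℝ) : ‖eChar k x‖ = 1 := by
  rw [eChar_eq_fourier, fourier_apply]
  exact Circle.norm_coe _

theorem eChar_add (k : ℕ) (x y : ℝ) : eChar k (x + y) = eChar k x * eChar k y := by
  simp only [eChar, ← Complex.exp_add]
  push_cast
  ring_nf

theorem norm_eChar_sub_one_sq (k : ℕ) (x : ℝ) :
    ‖eChar k x - 1‖ ^ 2 = 4 * Real.sin (π * k * x) ^ 2 := by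
  have h : eChar k x = Complex.exp (Complex.I * ((2 * π * k * x : ℝ) : ℂ)) := by
    rw [eChar]
    push_cast
    ring_nf
  rw [h, Complex.norm_exp_I_mul_ofReal_sub_one, Real.norm_eq_abs, sq_abs]
  ring_nf

theorem hasSum_structureFn_two (ℓ : ℝ) :
    HasSum (fun n : ℕ => 4 * Real.sin (π * (n : ℝ) ^ 2 * ℓ) ^ 2 / (n : ℝ) ^ 4)
      (structureFn 2 ℓ) := by
  have hsum (y : ℝ) : Summable fun n : ℕ => ((((n : ℝ) ^ 2)⁻¹ : ℝ) : ℂ) * eChar (n ^ 2) y :=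
    Summable.of_norm (by simp [norm_eChar])
  have hinj : Function.Injective fun n : ℕ => ((n ^ 2 : ℕ) : ℤ) := fun a b h =>
    Nat.pow_left_injective two_ne_zero (Nat.cast_injective h)
  have ha : Summable fun n : ℕ =>
      ‖((((n : ℝ) ^ 2)⁻¹ : ℝ) : ℂ) * (eChar (n ^ 2) ℓ - 1)‖ := by
    simp only [mul_sub, mul_one]
    exact ((hsum ℓ).sub (by simpa [eChar] using hsum 0)).norm
  have h := hasSum_norm_sq_of_summable_fourier hinj ha
  convert h using 1
  · ext n
    rw [norm_mul, mul_pow, norm_eChar_sub_one_sq, Complex.norm_real, Real.norm_eq_abs, sq_abs]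
    push_cast
    rw [inv_pow, ← pow_mul]
    ring
  · refine intervalIntegral.integral_congr fun x _ => ?_
    simp only [RiemannF_eq_tsum_sq, ← eChar_eq_fourier]
    rw [← (hsum _).tsum_sub (hsum _)]
    congr 2
    refine tsum_congr fun n => ?_
    rw [eChar_add]
    ring

theorem structureFn_two_le {ℓ : ℝ} (h0 : 0 < ℓ) :
    structureFn 2 ℓ ≤ (4 * π ^ 2 + 8) * √ℓ ^ 3 := by
  have hs : 0 < √ℓ := Real.sqrt_pos.mpr h0
  have hsq : √ℓ ^ 2 = ℓ := Real.sq_sqrt h0.le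
  set s := √ℓ
  set N := ⌊s⁻¹⌋₊
  have hN : (N : ℝ) ≤ s⁻¹ := Nat.floor_le (by positivity)
  have hN' : s⁻¹ < N + 1 := Nat.lt_floor_add_one _
  have hNs : ((N : ℝ) + 1)⁻¹ ≤ s := by
    rw [inv_le_comm₀ (by positivity) hs]
    exact hN'.le
  set f : ℕ → ℝ := fun n => 4 * Real.sin (π * (n : ℝ) ^ 2 * ℓ) ^ 2 / (n : ℝ) ^ 4
  have hf0 (n : ℕ) : 0 ≤ f n := by positivity
  have hlow (n : ℕ) (hn : 1 ≤ n) : f n ≤ 4 * π ^ 2 * s ^ 4 := by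
    have hn' : (0 : ℝ) < n := by exact_mod_cast hn
    have h1 : Real.sin (π * (n : ℝ) ^ 2 * ℓ) ^ 2 ≤ (π * (n : ℝ) ^ 2 * ℓ) ^ 2 := by
      rw [← sq_abs]
      have := Real.abs_sin_le_abs (x := π * (n : ℝ) ^ 2 * ℓ)
      rw [← sq_abs (π * (n : ℝ) ^ 2 * ℓ)]
      gcongr
    simp only [f]
    rw [div_le_iff₀ (by positivity)]
    calc _ ≤ 4 * (π * (n : ℝ) ^ 2 * ℓ) ^ 2 := by gcongr
      _ = _ := by rw [← hsq]; ring
  have hhigh (n : ℕ) (hn : N < n) : f n ≤ 4 * s ^ 2 * ((n : ℝ) ^ 2)⁻¹ := by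
    have hn1 : (N : ℝ) + 1 ≤ n := by exact_mod_cast hn
    have hn' : (0 : ℝ) < n := by linarith [inv_pos.mpr hs]
    have h2 : (n : ℝ)⁻¹ ≤ s := (inv_anti₀ (by positivity) hn1).trans hNs
    calc f n ≤ 4 * 1 / (n : ℝ) ^ 4 := by
            simp only [f]
            gcongr
            exact Real.sin_sq_le_one _
      _ = 4 * (n : ℝ)⁻¹ ^ 2 * ((n : ℝ) ^ 2)⁻¹ := by field_simp
      _ ≤ _ := by gcongr
  refine le_of_tendsto' (hasSum_structureFn_two ℓ).tendsto_sum_nat fun M => ?_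
  have hsub : Finset.range M ⊆ {0} ∪ (Finset.Icc 1 N ∪ Finset.Ioo N M) := by
    intro n hn
    simp only [Finset.mem_range, Finset.mem_union, Finset.mem_singleton, Finset.mem_Icc,
      Finset.mem_Ioo] at *
    omega
  have hunion (a b : Finset ℕ) : ∑ n ∈ a ∪ b, f n ≤ ∑ n ∈ a, f n + ∑ n ∈ b, f n := by
    rw [← Finset.sum_union_inter]
    exact le_add_of_nonneg_right (Finset.sum_nonneg fun n _ => hf0 n)
  calc ∑ n ∈ Finset.range M, f n ≤ ∑ n ∈ {0} ∪ (Finset.Icc 1 N ∪ Finset.Ioo N M), f n :=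
        Finset.sum_le_sum_of_subset_of_nonneg hsub fun n _ _ => hf0 n
    _ ≤ ∑ n ∈ {0}, f n + (∑ n ∈ Finset.Icc 1 N, f n + ∑ n ∈ Finset.Ioo N M, f n) :=
        (hunion _ _).trans (by gcongr; exact hunion _ _)
    _ ≤ 0 + (∑ n ∈ Finset.Icc 1 N, 4 * π ^ 2 * s ^ 4
          + ∑ n ∈ Finset.Ioo N M, 4 * s ^ 2 * ((n : ℝ) ^ 2)⁻¹) := by
        refine add_le_add (by simp [f]) (add_le_add ?_ ?_)
        · exact Finset.sum_le_sum fun n hn => hlow n (Finset.mem_Icc.mp hn).1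
        · exact Finset.sum_le_sum fun n hn => hhigh n (Finset.mem_Ioo.mp hn).1
    _ ≤ s⁻¹ * (4 * π ^ 2 * s ^ 4) + 4 * s ^ 2 * (2 * s) := by
        rw [zero_add, ← Finset.mul_sum _ _ (4 * s ^ 2), Finset.sum_const, nsmul_eq_mul, Nat.card_Icc,
          Nat.add_sub_cancel]
        have h3 : ∑ n ∈ Finset.Ioo N M, ((n : ℝ) ^ 2)⁻¹ ≤ 2 * s := by
          refine (sum_Ioo_inv_sq_le N M).trans ?_
          rw [div_eq_mul_inv]
          gcongr
        exact add_le_add (mul_le_mul_of_nonneg_right hN (by positivity))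
          (mul_le_mul_of_nonneg_left h3 (by positivity))
    _ = _ := by field_simp; ring

theorem le_structureFn_two {ℓ : ℝ} (h0 : 0 < ℓ) (h1 : ℓ < 1 / 2) :
    4 * √ℓ ^ 3 ≤ structureFn 2 ℓ := by
  have hs : 0 < √ℓ := Real.sqrt_pos.mpr h0
  have hsq : √ℓ ^ 2 = ℓ := Real.sq_sqrt h0.le
  set s := √ℓ
  have h2 : √2 ^ 2 = 2 := Real.sq_sqrt (by norm_num)
  have h2pos : 0 < √2 := by positivity
  set t := (√2 * s)⁻¹ with ht
  have htpos : 0 < t := by positivity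
  have ht2 : t ^ 2 * ℓ = 1 / 2 := by
    rw [ht, ← hsq, inv_pow, mul_pow, h2]
    field_simp
  have ht1 : 1 ≤ t := by
    by_contra! h
    nlinarith
  set N := ⌊t⌋₊
  have hNt : (N : ℝ) ≤ t := Nat.floor_le htpos.le
  have hN1 : (1 : ℝ) ≤ N := by exact_mod_cast (Nat.one_le_floor_iff t).mpr ht1
  have hN2 : t < N + 1 := Nat.lt_floor_add_one _
  have hts : 1 / (2 * s) ≤ t := by
    rw [ht, ← one_div]
    have : √2 ≤ 2 := by nlinarith
    gcongr
  have hNs : 1 / (4 * s) ≤ N := by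
    have : 1 / (4 * s) = 1 / (2 * s) / 2 := by field_simp; norm_num
    linarith
  have hlow (n : ℕ) (hn : n ∈ Finset.Icc 1 N) :
      16 * s ^ 4 ≤ 4 * Real.sin (π * (n : ℝ) ^ 2 * ℓ) ^ 2 / (n : ℝ) ^ 4 := by
    obtain ⟨hn1, hnN⟩ := Finset.mem_Icc.mp hn
    have hn' : (0 : ℝ) < n := by exact_mod_cast hn1
    have hnt : (n : ℝ) ≤ t := (Nat.cast_le.mpr hnN).trans hNt
    have hnl : (n : ℝ) ^ 2 * ℓ ≤ 1 / 2 := ht2 ▸ by gcongr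
    have hsin := Real.mul_le_sin (x := π * (n : ℝ) ^ 2 * ℓ) (by positivity)
      (by nlinarith [Real.pi_pos])
    have heq : 2 / π * (π * (n : ℝ) ^ 2 * ℓ) = 2 * (n : ℝ) ^ 2 * ℓ := by field_simp
    rw [heq] at hsin
    rw [le_div_iff₀ (by positivity)]
    calc 16 * s ^ 4 * (n : ℝ) ^ 4 = 4 * (2 * (n : ℝ) ^ 2 * ℓ) ^ 2 := by rw [← hsq]; ring
      _ ≤ _ := by gcongr
  calc 4 * s ^ 3 = 1 / (4 * s) * (16 * s ^ 4) := by field_simp; norm_num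
    _ ≤ N * (16 * s ^ 4) := by gcongr
    _ = ∑ n ∈ Finset.Icc 1 N, 16 * s ^ 4 := by simp
    _ ≤ _ := Finset.sum_le_sum hlow
    _ ≤ _ := sum_le_hasSum _ (fun n _ => by positivity) (hasSum_structureFn_two ℓ)

/-- There exist `c, C > 0` such that for every `0 < ℓ < 1/2`,
`c · ℓ^{3/2} ≤ S₂(ℓ) ≤ C · ℓ^{3/2}`. -/
theorem riemann_S2 :
    ∃ c C : ℝ, 0 < c ∧ 0 < C ∧ ∀ ℓ : ℝ, 0 < ℓ → ℓ < 1/2 →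
      c * ℓ ^ ((3:ℝ)/2) ≤ structureFn 2 ℓ ∧
      structureFn 2 ℓ ≤ C * ℓ ^ ((3:ℝ)/2) := by
  refine ⟨4, 4 * π ^ 2 + 8, by norm_num, by positivity, fun ℓ h0 h1 => ?_⟩
  have h : ℓ ^ ((3 : ℝ) / 2) = √ℓ ^ 3 := by
    rw [Real.sqrt_eq_rpow, ← Real.rpow_mul_natCast h0.le]
    norm_num
  rw [h]
  exact ⟨le_structureFn_two h0 h1, structureFn_two_le h0⟩
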